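/- arXiv:1902.11169 — 9 statements merged into one kernel-verified Lean document; each statement's English description precedes it below -/
import Mathlib

section
/- Let S be a finite set of points in the plane and p ∈ S. Then p is a vertex of the upper hull of S, i.e. p ∉ UC(S \ {p}), if and only if the dual line of p is strictly below the dual lines of all other points of S at some abscissa, i.e. there exists t ∈ ℝ such that for every q ∈ S with q ≠ p one has p.1·t − p.2 < q.1·t − q.2 (equivalently, p is the unique maximizer over S of the linear functional z ↦ z.2 − t·z.1). -/
/-- The downward closure (upper closure region) of a planar point set:
all points vertically below some point of the convex hull. -/
def UC (P : Set (ℝ × ℝ)) : Set (ℝ × ℝ) :=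
  {z : ℝ × ℝ | ∃ w ∈ convexHull ℝ P, z.1 = w.1 ∧ z.2 ≤ w.2}

open Filter Topology

/-- A point outside the downward closure of a finite set is strictly separated from that set by a
linear functional with positive vertical coefficient. -/
theorem exists_pos_separating_of_notMem_UC {P : Set (ℝ × ℝ)} (hP : P.Finite) {p : ℝ × ℝ}
    (hp : p ∉ UC P) :
    ∃ a b : ℝ, 0 < b ∧ ∀ q ∈ P, a * q.1 + b * q.2 < a * p.1 + b * p.2 := by
  have hdisj : Disjoint (convexHull ℝ P) ({p.1} ×ˢ Set.Ici p.2) :=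
    Set.disjoint_left.2 fun w hw hw' => hp ⟨w, hw, hw'.1.symm, hw'.2⟩
  obtain ⟨f, u, v, hu, huv, hv⟩ := geometric_hahn_banach_compact_closed (convex_convexHull ℝ P)
    (hP.isCompact_convexHull ℝ) ((convex_singleton p.1).prod (convex_Ici p.2))
    (isClosed_singleton.prod isClosed_Ici) hdisj
  have hf (z : ℝ × ℝ) : f z = f (1, 0) * z.1 + f (0, 1) * z.2 := by
    have hz : z = z.1 • ((1, 0) : ℝ × ℝ) + z.2 • ((0, 1) : ℝ × ℝ) := by ext <;> simp
    conv_lhs => rw [hz, map_add, map_smul, map_smul]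
    simp only [smul_eq_mul]
    ring
  set a := f (1, 0)
  set b := f (0, 1)
  have hvp : v < a * p.1 + b * p.2 := by
    rw [← hf]
    exact hv p ⟨rfl, le_refl p.2⟩
  have hb : 0 ≤ b := by
    by_contra! hb
    have hs : 0 ≤ (v - (a * p.1 + b * p.2)) / b :=
      div_nonneg_of_nonpos (by linarith) hb.le
    have h := hv (p.1, p.2 + (v - (a * p.1 + b * p.2)) / b)
      ⟨rfl, le_add_of_nonneg_right hs⟩
    rw [hf, mul_add, mul_div_cancel₀ _ hb.ne] at h
    linarith
  have hlt (q : ℝ × ℝ) (hq : q ∈ P) : a * q.1 + b * q.2 < a * p.1 + b * p.2 := by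
    have h := hu q (subset_convexHull ℝ P hq)
    rw [hf] at h
    linarith
  have hev : ∀ᶠ c in 𝓝 b, ∀ q ∈ P, a * q.1 + c * q.2 < a * p.1 + c * p.2 :=
    hP.eventually_all.2 fun q hq =>
      ContinuousAt.eventually_lt (by fun_prop) (by fun_prop) (hlt q hq)
  obtain ⟨c, hc, hbc⟩ :=
    ((hev.filter_mono nhdsWithin_le_nhds).and (self_mem_nhdsWithin (s := Set.Ioi b))).exists
  exact ⟨a, c, hb.trans_lt hbc, hc⟩

/-- A point `p ∈ S` is a vertex of the upper hull of `S` (i.e. `p ∉ UC (S \ {p})`)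
iff its dual line is strictly below the dual lines of all other points of `S`
at some abscissa `t`. -/
theorem upper_hull_vertex_iff_dual_strictly_min
    (S : Finset (ℝ × ℝ)) (p : ℝ × ℝ) (hp : p ∈ S) :
    p ∉ UC ((S : Set (ℝ × ℝ)) \ {p}) ↔
      ∃ t : ℝ, ∀ q ∈ S, q ≠ p → p.1 * t - p.2 < q.1 * t - q.2 := by
  constructor
  · intro h
    obtain ⟨a, b, hb, hab⟩ := exists_pos_separating_of_notMem_UC S.finite_toSet.sdiff h
    refine ⟨-a / b, fun q hq hqp => ?_⟩
    have hdiv (z : ℝ × ℝ) : z.1 * (-a / b) - z.2 = -(a * z.1 + b * z.2) / b := by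
      field_simp
      ring
    rw [hdiv, hdiv]
    exact div_lt_div_of_pos_right (neg_lt_neg (hab q ⟨hq, hqp⟩)) hb
  · rintro ⟨t, ht⟩ ⟨w, hw, hw₁, hw₂⟩
    have hlin : IsLinearMap ℝ fun z : ℝ × ℝ => z.1 * t - z.2 :=
      ⟨fun x y => by simp; ring, fun c x => by simp; ring⟩
    have hmem : p.1 * t - p.2 < w.1 * t - w.2 :=
      convexHull_min (fun q hq => ht q hq.1 hq.2)
        (convex_halfSpace_gt hlin (p.1 * t - p.2)) hw
    rw [hw₁] at hmem
    linarith
end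

section
/- Let X ⊆ ℝ² be a finite set and x, p, y ∈ X with x.1 < p.1 < y.1. Assume every point of X lies weakly below the line through x and p, and weakly below the line through p and y (so these two lines support the upper hull of X at p). Define the left ray of p as Lray(p) = {p + t·(p − y) : t ≥ 0} and the right ray of p as Rray(p) = {p + t·(p − x) : t ≥ 0}. If ℓ is a line containing two distinct points u ∈ Lray(p) and v ∈ Rray(p), then ℓ does not intersect the interior of UC(X). -/
/-- `z` lies weakly below the line through `a` and `b` (where `a.1 < b.1`). -/
def WeaklyBelow (a b z : ℝ × ℝ) : Prop :=
  (b.1 - a.1) * (z.2 - a.2) ≤ (b.2 - a.2) * (z.1 - a.1)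

/-- The closed half-plane weakly below a line is convex. -/
theorem convex_setOf_weaklyBelow (a b : ℝ × ℝ) : Convex ℝ {z | WeaklyBelow a b z} := by
  intro z hz w hw α β hα hβ hαβ
  simp only [Set.mem_ofPred_eq, WeaklyBelow, Prod.fst_add, Prod.snd_add, Prod.smul_fst,
    Prod.smul_snd, smul_eq_mul] at *
  obtain rfl : β = 1 - α := by linarith
  nlinarith [mul_le_mul_of_nonneg_left hz hα, mul_le_mul_of_nonneg_left hw hβ]

/-- A nonvertical line supporting `P` from above also supports `UC P`. -/
theorem weaklyBelow_of_mem_UC {P : Set (ℝ × ℝ)} {a b z : ℝ × ℝ} (hab : a.1 < b.1)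
    (hP : ∀ w ∈ P, WeaklyBelow a b w) (hz : z ∈ UC P) : WeaklyBelow a b z := by
  obtain ⟨w, hw, h₁, h₂⟩ := hz
  have hw' : WeaklyBelow a b w := convexHull_min hP (convex_setOf_weaklyBelow a b) hw
  unfold WeaklyBelow at *
  rw [h₁]
  nlinarith

/-- Interior points of `UC P` lie strictly below every nonvertical line supporting `P`
from above. -/
theorem strictlyBelow_of_mem_interior_UC {P : Set (ℝ × ℝ)} {a b z : ℝ × ℝ} (hab : a.1 < b.1)
    (hP : ∀ w ∈ P, WeaklyBelow a b w) (hz : z ∈ interior (UC P)) :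
    (b.1 - a.1) * (z.2 - a.2) < (b.2 - a.2) * (z.1 - a.1) := by
  obtain ⟨ε, hε, hball⟩ := Metric.isOpen_iff.1 isOpen_interior z hz
  have hmem : (z.1, z.2 + ε / 2) ∈ Metric.ball z ε := by
    rw [Metric.mem_ball, Prod.dist_eq]
    simp [abs_of_pos hε, hε]
  have h := weaklyBelow_of_mem_UC hab hP (interior_subset (hball hmem))
  simp only [WeaklyBelow] at h
  nlinarith [mul_pos (sub_pos.2 hab) hε]

/-- Lemma `rayAbove`: if the two segments of the upper hull of `X` incident to `p`
support `X` (every point of `X` is weakly below the lines through `x,p` and `p,y`),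
then any line through a point `u` of the left ray of `p` and a point `v` of the
right ray of `p` avoids the interior of `UC X`. -/
theorem line_through_rays_misses_interior_UC
    (X : Finset (ℝ × ℝ)) (x p y : ℝ × ℝ)
    (hx : x ∈ X) (hp : p ∈ X) (hy : y ∈ X)
    (hxp : x.1 < p.1) (hpy : p.1 < y.1)
    (hsupp1 : ∀ z ∈ X, WeaklyBelow x p z)
    (hsupp2 : ∀ z ∈ X, WeaklyBelow p y z)
    (u v : ℝ × ℝ) (huv : u ≠ v)
    (hu : ∃ t : ℝ, 0 ≤ t ∧ u = p + t • (p - y))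
    (hv : ∃ t : ℝ, 0 ≤ t ∧ v = p + t • (p - x)) :
    ∀ s : ℝ, u + s • (v - u) ∉ interior (UC (X : Set (ℝ × ℝ))) := by
  intro s hs
  have h₁ := strictlyBelow_of_mem_interior_UC hxp hsupp1 hs
  have h₂ := strictlyBelow_of_mem_interior_UC hpy hsupp2 hs
  have hK := hsupp1 y hy
  obtain ⟨t, ht, rfl⟩ := hu
  obtain ⟨r, hr, rfl⟩ := hv
  simp only [WeaklyBelow, Prod.fst_add, Prod.snd_add, Prod.fst_sub, Prod.snd_sub, Prod.smul_fst,
    Prod.smul_snd, smul_eq_mul] at h₁ h₂ hK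
  set K := (p.2 - x.2) * (y.1 - p.1) - (p.1 - x.1) * (y.2 - p.2) with hK_def
  have hK₀ : 0 ≤ K := by linarith
  have hs₁ : (1 - s) * (t * K) < 0 := by
    rw [hK_def]
    linarith
  have hs₂ : s * (r * K) < 0 := by
    rw [hK_def]
    linarith
  have hs_gt : 1 - s < 0 := neg_of_mul_neg_left hs₁ (mul_nonneg ht hK₀)
  have hs_lt : s < 0 := neg_of_mul_neg_left hs₂ (mul_nonneg hr hK₀)
  linarith
end

section
/- Let 𝓘 be a finite family of pairwise disjoint closed intervals of ℝ, and let V ⊆ ℝ be a set such that the interior of every interval in 𝓘 contains at least one point of V. Let a < b < c be real numbers with V ∩ (a, c) = {b}. Then at most 3 intervals of 𝓘 intersect the open interval (a, c). -/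
open Set

/-- A pairwise disjoint family of sets, each of which meets a finite set `T`, has at most
`T.ncard` members. -/
theorem ncard_le_ncard_of_disjoint_of_inter_nonempty {ι α : Type*} {s : Set ι} {f : ι → Set α}
    {T : Set α} (hT : T.Finite) (hdisj : s.PairwiseDisjoint f)
    (hmeet : ∀ i ∈ s, (f i ∩ T).Nonempty) : s.ncard ≤ T.ncard := by
  rcases T.eq_empty_or_nonempty with rfl | ⟨x, -⟩
  · rw [show s = ∅ from eq_empty_of_forall_notMem fun i hi => by simpa using hmeet i hi]
    simp
  have : Nonempty α := ⟨x⟩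
  choose! g hg using hmeet
  refine Set.ncard_le_ncard_of_injOn g (fun i hi => (hg i hi).2) (fun i hi j hj hij => ?_) hT
  exact hdisj.elim_set hi hj (g i) (hg i hi).1 (hij ▸ (hg j hj).1)

/-- Combinatorial core of Lemma `FewShortcuts`: if `𝓘` is a finite family of
pairwise disjoint closed intervals (given by their endpoint pairs), each of
whose open interiors contains a point of `V`, and `V ∩ (a, c) = {b}` for some
`a < b < c`, then at most 3 of the intervals intersect `(a, c)`. -/
theorem at_most_three_intervals_meet_slab
    (𝓘 : Finset (ℝ × ℝ)) (V : Set ℝ)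
    (hdisj : ∀ I ∈ 𝓘, ∀ J ∈ 𝓘, I ≠ J → Disjoint (Icc I.1 I.2) (Icc J.1 J.2))
    (heff : ∀ I ∈ 𝓘, ∃ v ∈ V, v ∈ Ioo I.1 I.2)
    (a b c : ℝ) (hab : a < b) (hbc : b < c)
    (hV : V ∩ Ioo a c = {b}) :
    {I : ℝ × ℝ | I ∈ 𝓘 ∧ (Icc I.1 I.2 ∩ Ioo a c).Nonempty}.ncard ≤ 3 := by
  have hmeet : ∀ I ∈ {I : ℝ × ℝ | I ∈ 𝓘 ∧ (Icc I.1 I.2 ∩ Ioo a c).Nonempty},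
      (Icc I.1 I.2 ∩ {a, b, c}).Nonempty := by
    rintro I ⟨hI, t, ⟨h1t, ht2⟩, hat, htc⟩
    obtain ⟨v, hvV, h1v, hv2⟩ := heff I hI
    rcases le_or_gt v a with hva | hav
    · exact ⟨a, ⟨h1v.le.trans hva, hat.le.trans ht2⟩, by simp⟩
    rcases le_or_gt c v with hcv | hvc
    · exact ⟨c, ⟨h1t.trans htc.le, hcv.trans hv2.le⟩, by simp⟩
    have hvb : v ∈ ({b} : Set ℝ) := hV ▸ ⟨hvV, hav, hvc⟩
    obtain rfl := mem_singleton_iff.mp hvb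
    exact ⟨v, ⟨h1v.le, hv2.le⟩, by simp⟩
  exact (ncard_le_ncard_of_disjoint_of_inter_nonempty (toFinite _)
    (fun I hI J hJ hIJ => hdisj I hI.1 J hJ.1 hIJ) hmeet).trans
    (Set.ncard_eq_three.mpr ⟨a, b, c, hab.ne, (hab.trans hbc).ne, hbc.ne, rfl⟩).le
end

section
/- Let x, y, p, q ∈ ℝ² with x.1 < y.1 and p.1 < q.1, and suppose p and q both lie strictly below the line through x and y. Let d_p, d_q ∈ ℝ² be nonzero directions with d_p.1 ≤ 0 and d_q.1 ≥ 0, and let R_p = {p + t·d_p : t ≥ 0} and R_q = {q + t·d_q : t ≥ 0}. Assume every point of R_p and every point of R_q lies weakly below the line through p and q. Then R_p and R_q cannot both intersect the closed segment from x to y. -/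
/-- `z` lies strictly below the line through `a` and `b` (where `a.1 < b.1`). -/
def StrictlyBelow (a b z : ℝ × ℝ) : Prop :=
  (b.1 - a.1) * (z.2 - a.2) < (b.2 - a.2) * (z.1 - a.1)

/-- Points of the segment from `x` to `y` satisfy the equation of the line through `x` and `y`. -/
theorem line_eq_of_mem_segment {x y z : ℝ × ℝ} (hz : z ∈ segment ℝ x y) :
    (y.1 - x.1) * (z.2 - x.2) = (y.2 - x.2) * (z.1 - x.1) := by
  rw [segment_eq_image'] at hz
  obtain ⟨θ, -, rfl⟩ := hz
  simp only [Prod.fst_add, Prod.snd_add, Prod.smul_fst, Prod.smul_snd, Prod.fst_sub,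
    Prod.snd_sub, smul_eq_mul]
  ring

/-- If `r` is strictly below the line through `x` and `y`, and `r + v` lies on the segment
from `x` to `y`, then a direction `w` with `0 < w.1` such that `v` is weakly below the line
spanned by `w` is steeper than `y - x` if `0 < v.1` and less steep if `v.1 < 0`. -/
theorem slope_comparison_of_mem_segment {x y r v w : ℝ × ℝ} (hxy : x.1 < y.1)
    (hr : StrictlyBelow x y r) (hv : r + v ∈ segment ℝ x y) (hw : 0 < w.1)
    (hvw : w.1 * v.2 ≤ w.2 * v.1) :
    0 < ((y.1 - x.1) * w.2 - (y.2 - x.2) * w.1) * v.1 := by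
  have hline := line_eq_of_mem_segment hv
  simp only [StrictlyBelow] at hr
  simp only [Prod.fst_add, Prod.snd_add] at hline
  have habove : (y.2 - x.2) * v.1 < (y.1 - x.1) * v.2 := by linarith
  have h₁ := mul_lt_mul_of_pos_left habove hw
  have h₂ := mul_le_mul_of_nonneg_left hvw (sub_pos.2 hxy).le
  linarith

/-- Geometric core of Lemma `LimitedRays`: if `p` and `q` (with `p.1 < q.1`) lie
strictly below the segment `xy`, the leftward ray from `p` and the rightward ray
from `q` both stay weakly below the line through `p` and `q`, then the two rays
cannot both meet the closed segment from `x` to `y`. -/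
theorem rays_cannot_both_meet_segment
    (x y p q dp dq : ℝ × ℝ)
    (hxy : x.1 < y.1) (hpq : p.1 < q.1)
    (hp : StrictlyBelow x y p) (hq : StrictlyBelow x y q)
    (hdp0 : dp ≠ 0) (hdq0 : dq ≠ 0)
    (hdp1 : dp.1 ≤ 0) (hdq1 : 0 ≤ dq.1)
    (hRp : ∀ t : ℝ, 0 ≤ t → WeaklyBelow p q (p + t • dp))
    (hRq : ∀ t : ℝ, 0 ≤ t → WeaklyBelow p q (q + t • dq)) :
    ¬((∃ t : ℝ, 0 ≤ t ∧ p + t • dp ∈ segment ℝ x y) ∧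
      (∃ t : ℝ, 0 ≤ t ∧ q + t • dq ∈ segment ℝ x y)) := by
  rintro ⟨⟨s, hs, hps⟩, ⟨t, ht, hqt⟩⟩
  have hw : 0 < (q - p).1 := sub_pos.2 hpq
  have hsp := hRp s hs
  have htq := hRq t ht
  simp only [WeaklyBelow, Prod.fst_add, Prod.snd_add] at hsp htq
  have h₁ := slope_comparison_of_mem_segment (w := q - p) hxy hp hps hw (by
    simp only [Prod.fst_sub, Prod.snd_sub]
    linarith)
  have h₂ := slope_comparison_of_mem_segment (w := q - p) hxy hq hqt hw (by
    simp only [Prod.fst_sub, Prod.snd_sub]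
    linarith)
  have hu : (s • dp).1 ≤ 0 := mul_nonpos_of_nonneg_of_nonpos hs hdp1
  have hv : 0 ≤ (t • dq).1 := mul_nonneg ht hdq1
  exact (neg_of_mul_pos_left h₁ hu).not_gt (pos_of_mul_pos_left h₂ hv)
end

section
/- Let S' ⊆ S be finite nonempty sets of affine functions ℝ → ℝ, and let m(x) = min_{f ∈ S} f(x) and m'(x) = min_{f ∈ S'} f(x) be their lower envelopes. Let t₁ < t₂ be real numbers with m(t₁) = m'(t₁) and m(t₂) = m'(t₂). Let ℓ : ℝ → ℝ be an affine function and set I = {x : ℓ(x) ≤ m(x)} and I' = {x : ℓ(x) ≤ m'(x)}. Assume I is nonempty, I' is bounded above, and t₁ ≤ sup I' ≤ t₂. Then I is nonempty and bounded above and t₁ ≤ sup I ≤ t₂. -/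
open Set

/-- The set of abscissas where a line is on or below a lower envelope is closed. -/
lemma isClosed_le_lowerEnvelope (S : Finset (ℝ × ℝ)) (hS : S.Nonempty) (a b : ℝ) :
    IsClosed {x : ℝ | a * x + b ≤ S.inf' hS (fun f => f.1 * x + f.2)} := by
  refine isClosed_le (by fun_prop) ?_
  exact Continuous.finset_inf'_apply hS fun f _ => by fun_prop

/-- The set of abscissas where a line is on or below a lower envelope is an interval. -/
lemma ordConnected_le_lowerEnvelope (S : Finset (ℝ × ℝ)) (hS : S.Nonempty) (a b : ℝ) :
    OrdConnected {x : ℝ | a * x + b ≤ S.inf' hS (fun f => f.1 * x + f.2)} := by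
  refine ⟨fun x hx y hy z hz => ?_⟩
  simp only [mem_ofPred_eq, Finset.le_inf'_iff] at hx hy ⊢
  intro f hf
  have hfx := hx f hf
  have hfy := hy f hf
  rcases le_total a f.1 with h | h
  · nlinarith [mul_nonneg (sub_nonneg.2 h) (sub_nonneg.2 hz.1)]
  · nlinarith [mul_nonneg (sub_nonneg.2 h) (sub_nonneg.2 hz.2)]

/-- Lemma `tangent`: let `m` and `m'` be the lower envelopes of finite nonempty
sets `S' ⊆ S` of affine functions (coded by coefficient pairs `(slope, offset)`),
agreeing at two abscissas `t₁ < t₂`.  If the set `I'` of abscissas where the query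
line `ℓ` is on or below `m'` is bounded above with `t₁ ≤ sup I' ≤ t₂`, and the
corresponding set `I` for `m` is nonempty, then `I` is nonempty, bounded above,
and `t₁ ≤ sup I ≤ t₂`. -/
theorem right_intersection_in_slab
    (S S' : Finset (ℝ × ℝ)) (hS : S.Nonempty) (hS' : S'.Nonempty) (hsub : S' ⊆ S)
    (la lb t₁ t₂ : ℝ) (ht12 : t₁ < t₂)
    (h1 : S.inf' hS (fun f => f.1 * t₁ + f.2) = S'.inf' hS' (fun f => f.1 * t₁ + f.2))
    (h2 : S.inf' hS (fun f => f.1 * t₂ + f.2) = S'.inf' hS' (fun f => f.1 * t₂ + f.2))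
    (hIne : {x : ℝ | la * x + lb ≤ S.inf' hS (fun f => f.1 * x + f.2)}.Nonempty)
    (hI'bdd : BddAbove {x : ℝ | la * x + lb ≤ S'.inf' hS' (fun f => f.1 * x + f.2)})
    (hlo : t₁ ≤ sSup {x : ℝ | la * x + lb ≤ S'.inf' hS' (fun f => f.1 * x + f.2)})
    (hhi : sSup {x : ℝ | la * x + lb ≤ S'.inf' hS' (fun f => f.1 * x + f.2)} ≤ t₂) :
    {x : ℝ | la * x + lb ≤ S.inf' hS (fun f => f.1 * x + f.2)}.Nonempty ∧
    BddAbove {x : ℝ | la * x + lb ≤ S.inf' hS (fun f => f.1 * x + f.2)} ∧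
    t₁ ≤ sSup {x : ℝ | la * x + lb ≤ S.inf' hS (fun f => f.1 * x + f.2)} ∧
    sSup {x : ℝ | la * x + lb ≤ S.inf' hS (fun f => f.1 * x + f.2)} ≤ t₂ := by
  have hII' : {x : ℝ | la * x + lb ≤ S.inf' hS (fun f => f.1 * x + f.2)} ⊆
      {x : ℝ | la * x + lb ≤ S'.inf' hS' (fun f => f.1 * x + f.2)} :=
    ofPred_subset_ofPred.2 fun x hx => hx.trans (Finset.inf'_mono _ hsub hS')
  have hIbdd := hI'bdd.mono hII'
  refine ⟨hIne, hIbdd, ?_, (csSup_le_csSup hI'bdd hIne hII').trans hhi⟩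
  obtain ⟨p, hp⟩ := hIne
  rcases le_total t₁ p with h | h
  · exact h.trans (le_csSup hIbdd hp)
  · have hmem := (ordConnected_le_lowerEnvelope S' hS' la lb).out (hII' hp)
      ((isClosed_le_lowerEnvelope S' hS' la lb).csSup_mem ⟨p, hII' hp⟩ hI'bdd) ⟨h, hlo⟩
    exact le_csSup hIbdd (le_of_le_of_eq hmem h1.symm)
end

section
/- For all natural numbers n₁ ≥ 1 and n₂ ≥ 1 with n = n₁ + n₂, one has (using the real base-2 logarithm) log₂ n₁ + log₂ n₂ − log₂ n ≥ log₂ (min(n₁, n₂)) − 1; equivalently, with the potential φ(k) = k − log₂ k, splitting a split-array of size n into parts of sizes n₁ and n₂ releases potential φ(n) − φ(n₁) − φ(n₂) ≥ log₂ (min(n₁, n₂)) − 1. -/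
/-- The base-2 logarithm of a sum exceeds that of the larger summand by at most one. -/
theorem logb_two_add_le {a b : ℝ} (ha : 0 < a) (hb : 0 < b) (hab : a ≤ b) :
    Real.logb 2 (a + b) ≤ 1 + Real.logb 2 b := by
  calc Real.logb 2 (a + b) ≤ Real.logb 2 (2 * b) :=
        Real.logb_le_logb_of_le one_lt_two (by positivity) (by linarith)
    _ = 1 + Real.logb 2 b := by
        rw [Real.logb_mul two_ne_zero hb.ne', Real.logb_self_eq_one one_lt_two]

/-- Split-array potential inequality: for `n = n₁ + n₂` with `n₁, n₂ ≥ 1`,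
`log₂ n₁ + log₂ n₂ − log₂ n ≥ log₂ (min n₁ n₂) − 1`; equivalently, with the
potential `φ(k) = k − log₂ k`, a split releases potential
`φ(n) − φ(n₁) − φ(n₂) ≥ log₂ (min n₁ n₂) − 1`. -/
theorem split_array_potential_release
    (n n₁ n₂ : ℕ) (h₁ : 1 ≤ n₁) (h₂ : 1 ≤ n₂) (hn : n = n₁ + n₂) :
    Real.logb 2 ((min n₁ n₂ : ℕ) : ℝ) - 1 ≤
      Real.logb 2 (n₁ : ℝ) + Real.logb 2 (n₂ : ℝ) - Real.logb 2 (n : ℝ) ∧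
    Real.logb 2 ((min n₁ n₂ : ℕ) : ℝ) - 1 ≤
      ((n : ℝ) - Real.logb 2 (n : ℝ)) - ((n₁ : ℝ) - Real.logb 2 (n₁ : ℝ))
        - ((n₂ : ℝ) - Real.logb 2 (n₂ : ℝ)) := by
  have hpos₁ : (0 : ℝ) < n₁ := by exact_mod_cast h₁
  have hpos₂ : (0 : ℝ) < n₂ := by exact_mod_cast h₂
  have hcast : (n : ℝ) = n₁ + n₂ := by exact_mod_cast hn
  have key : Real.logb 2 ((min n₁ n₂ : ℕ) : ℝ) - 1 ≤
      Real.logb 2 (n₁ : ℝ) + Real.logb 2 (n₂ : ℝ) - Real.logb 2 (n : ℝ) := by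
    rw [hcast]
    rcases le_total n₁ n₂ with h | h
    · rw [min_eq_left h]
      linarith [logb_two_add_le hpos₁ hpos₂ (by exact_mod_cast h)]
    · rw [min_eq_right h, add_comm (n₁ : ℝ)]
      linarith [logb_two_add_le hpos₂ hpos₁ (by exact_mod_cast h)]
  exact ⟨key, by linarith⟩
end

section
/- For natural numbers n, k ≥ 1, let D_{n,k} ⊆ (Fin n → ℝ) × (Fin k → ℝ) be the set of pairs (x, y) such that y is strictly monotone (y_1 < y_2 < ⋯ < y_k) and x_i ≠ y_j for all i and j, equipped with the subspace topology of ℝ^{n+k}. Define the distribution of (x, y) ∈ D_{n,k} to be the function Fin n → ℕ sending i to the number of indices j with y_j < x_i. If (x, y) and (x', y') lie in the same connected component of D_{n,k}, then they have the same distribution. -/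
open scoped Classical

/-- Continuous functions that never agree on a preconnected set are ordered the same way
throughout the set. -/
theorem IsPreconnected.lt_of_lt_of_forall_ne {X α : Type*} [TopologicalSpace X]
    [LinearOrder α] [TopologicalSpace α] [OrderClosedTopology α] {s : Set X}
    (hs : IsPreconnected s) {f g : X → α} (hf : ContinuousOn f s) (hg : ContinuousOn g s)
    (hne : ∀ x ∈ s, f x ≠ g x) {a b : X} (ha : a ∈ s) (hb : b ∈ s) (hab : f a < g a) :
    f b < g b := by
  by_contra! hle
  obtain ⟨x, hx, hfg⟩ := hs.intermediate_value₂ ha hb hf hg hab.le hle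
  exact hne x hx hfg

/-- Points of the same connected component of `DisjointSet_{n,k}` have the same
distribution: the distribution of `(x, y)` records, for each `i`, the number of
indices `j` with `y j < x i`. -/
theorem same_component_same_distribution
    (n k : ℕ) (hn : 1 ≤ n) (hk : 1 ≤ k)
    (D : Set ((Fin n → ℝ) × (Fin k → ℝ)))
    (hD : D = {p | StrictMono p.2 ∧ ∀ i j, p.1 i ≠ p.2 j})
    (p q : (Fin n → ℝ) × (Fin k → ℝ))
    (hpD : p ∈ D) (hqD : q ∈ D)
    (hcomp : q ∈ connectedComponentIn D p) :
    (fun i : Fin n => (Finset.univ.filter (fun j : Fin k => p.2 j < p.1 i)).card) =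
    (fun i : Fin n => (Finset.univ.filter (fun j : Fin k => q.2 j < q.1 i)).card) := by
  have hne : ∀ i j, ∀ z ∈ connectedComponentIn D p, z.2 j ≠ z.1 i := by
    intro i j z hz
    have hzD := connectedComponentIn_subset D p hz
    rw [hD] at hzD
    exact (hzD.2 i j).symm
  have hp := mem_connectedComponentIn hpD
  have hlt : ∀ i j, ∀ a ∈ connectedComponentIn D p, ∀ b ∈ connectedComponentIn D p,
      a.2 j < a.1 i → b.2 j < b.1 i := fun i j a ha b hb =>
    isPreconnected_connectedComponentIn.lt_of_lt_of_forall_ne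
      (f := fun z : (Fin n → ℝ) × (Fin k → ℝ) => z.2 j) (g := fun z => z.1 i)
      (by fun_prop) (by fun_prop) (hne i j) ha hb
  funext i
  congr 1
  ext j
  simpa using ⟨hlt i j p hp q hcomp, hlt i j q hcomp p hp⟩
end

section
/- For natural numbers n, k ≥ 1, let D_{n,k} ⊆ (Fin n → ℝ) × (Fin k → ℝ) be the set of pairs (x, y) such that y is strictly monotone and x_i ≠ y_j for all i and j, with the subspace topology of ℝ^{n+k}. Then D_{n,k} has at least (k+1)^n connected components; concretely, there is an injection from the set of functions Fin n → Fin (k+1) into the set of connected components of D_{n,k} (e.g. taking y_j = j and placing each x_i into a prescribed one of the k+1 open intervals of ℝ \ {1,…,k} yields points lying in pairwise distinct connected components). -/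
/-- If `f` and `g` are continuous and never agree, the comparison `f x < g x` is a continuous
function of `x` with values in the discrete space `Bool`. -/
theorem continuous_decide_lt_of_forall_ne {X α : Type*} [TopologicalSpace X] [TopologicalSpace α]
    [LinearOrder α] [OrderClosedTopology α] {f g : X → α} (hf : Continuous f) (hg : Continuous g)
    (hne : ∀ x, f x ≠ g x) : Continuous fun x => decide (f x < g x) := by
  rw [continuous_bool_rng true]
  refine ⟨?_, ?_⟩
  · convert isClosed_le hf hg using 1
    ext x
    simp [le_iff_lt_or_eq, hne x]
  · convert isOpen_lt hf hg using 1
    ext x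
    simp

/-- An element of `Fin (k + 1)` is determined by the elements of `Fin k` below it. -/
theorem Fin.eq_of_forall_castSucc_lt_iff {k : ℕ} {a b : Fin (k + 1)}
    (h : ∀ j : Fin k, j.castSucc < a ↔ j.castSucc < b) : a = b := by
  by_contra hab
  rcases lt_or_gt_of_ne hab with hlt | hlt
  · exact lt_irrefl a ((h ⟨a, by omega⟩).2 hlt)
  · exact lt_irrefl b ((h ⟨b, by omega⟩).1 hlt)

/-- `DisjointSet_{n,k}` (as a subspace of `ℝ^{n+k}`) has at least `(k+1)^n`
connected components: there is an injection from `Fin n → Fin (k+1)` into the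
set of connected components. -/
theorem disjointSet_many_components
    (n k : ℕ) (hn : 1 ≤ n) (hk : 1 ≤ k) :
    ∃ f : (Fin n → Fin (k + 1)) →
        ConnectedComponents
          {p : (Fin n → ℝ) × (Fin k → ℝ) // StrictMono p.2 ∧ ∀ i j, p.1 i ≠ p.2 j},
      Function.Injective f := by
  let D := {p : (Fin n → ℝ) × (Fin k → ℝ) // StrictMono p.2 ∧ ∀ i j, p.1 i ≠ p.2 j}
  let signs : D → Fin n → Fin k → Bool := fun p i j => decide (p.1.2 j < p.1.1 i)
  have signs_cont : Continuous signs :=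
    continuous_pi fun i => continuous_pi fun j =>
      continuous_decide_lt_of_forall_ne (f := fun p : D => p.1.2 j) (g := fun p : D => p.1.1 i)
        (by fun_prop) (by fun_prop) fun p => (p.2.2 i j).symm
  let point : (Fin n → Fin (k + 1)) → D := fun c =>
    ⟨(fun i => ((2 * (c i : ℤ) - 1 : ℤ) : ℝ), fun j => ((2 * (j : ℤ) : ℤ) : ℝ)),
      fun a b hab => Int.cast_lt.2 (by have : (a : ℕ) < b := hab; omega),
      fun i j h => by have := Int.cast_injective h; omega⟩
  refine ⟨fun c => ConnectedComponents.mk (point c), fun c d hcd => ?_⟩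
  have hsigns : signs (point c) = signs (point d) :=
    signs_cont.image_eq_of_connectedComponent_eq _ _ (ConnectedComponents.coe_eq_coe.1 hcd)
  funext i
  refine Fin.eq_of_forall_castSucc_lt_iff fun j => ?_
  have hij : (2 * (j : ℤ) < 2 * (c i : ℤ) - 1) ↔ (2 * (j : ℤ) < 2 * (d i : ℤ) - 1) := by
    simpa only [signs, point, decide_eq_decide, Int.cast_lt] using congrFun (congrFun hsigns i) j
  simp only [Fin.lt_def, Fin.val_castSucc]
  omega
end

section
/- Let A and B be finite nonempty subsets of ℝ². For a finite nonempty P ⊆ ℝ² and t ∈ ℝ with {y : (t, y) ∈ convexHull ℝ P} nonempty, let f_P(t) denote the supremum of that set (the upper-hull function). Suppose t⁻ < t₀ < t⁺ are real numbers such that f_A and f_B are defined on all of [t⁻, t⁺], f_A(t) < f_B(t) for all t ∈ [t⁻, t₀), f_A(t) > f_B(t) for all t ∈ (t₀, t⁺], and t₀ is not the first coordinate of any point of A ∪ B. Then there exist a ∈ A and b ∈ B such that every point of A ∪ B lies weakly below the line through a and b, and the open interval between a.1 and b.1 contains t₀. -/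
open Set

/-- The upper-hull function of a planar point set `P` at abscissa `t`:
the supremum of the vertical slice of the convex hull over `t`. -/
noncomputable def upperF (P : Set (ℝ × ℝ)) (t : ℝ) : ℝ :=
  sSup {y : ℝ | (t, y) ∈ convexHull ℝ P}

/-- The points weakly below a given line form a convex set. -/
theorem convex_setOf_weaklyBelow_s14 (p q : ℝ × ℝ) : Convex ℝ {z | WeaklyBelow p q z} := by
  intro x hx y hy a b ha hb hab
  simp only [mem_ofPred_eq, WeaklyBelow, Prod.fst_add, Prod.snd_add, Prod.smul_fst, Prod.smul_snd,
    smul_eq_mul] at hx hy ⊢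
  obtain rfl : b = 1 - a := by linarith
  linear_combination a * hx + (1 - a) * hy

/-- Abscissae of points of `P` occur on both sides of any abscissa met by its convex hull. -/
theorem exists_fst_le_and_exists_le_fst {P : Set (ℝ × ℝ)} {t y : ℝ}
    (h : (t, y) ∈ convexHull ℝ P) : (∃ p ∈ P, p.1 ≤ t) ∧ ∃ q ∈ P, t ≤ q.1 := by
  constructor
  · by_contra! hP
    have hsub : convexHull ℝ P ⊆ {z | t < z.1} :=
      convexHull_min hP (convex_halfSpace_gt (LinearMap.fst ℝ ℝ ℝ).isLinear t)
    exact lt_irrefl t (hsub h)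
  · by_contra! hP
    have hsub : convexHull ℝ P ⊆ {z | z.1 < t} :=
      convexHull_min hP (convex_halfSpace_lt (LinearMap.fst ℝ ℝ ℝ).isLinear t)
    exact lt_irrefl t (hsub h)

/-- If the segment from `p ∈ S` to `q ∈ S` supports both `S` and `T` from above, then the upper
hull of `T` does not exceed that of `S` over this segment. -/
theorem upperF_le_upperF_of_weaklyBelow {S T : Set (ℝ × ℝ)} {p q : ℝ × ℝ} {t : ℝ}
    (hp : p ∈ S) (hq : q ∈ S) (hpq : p.1 < q.1)
    (hS : ∀ z ∈ S, WeaklyBelow p q z) (hT : ∀ z ∈ T, WeaklyBelow p q z)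
    (ht : t ∈ Icc p.1 q.1) (hne : {y : ℝ | (t, y) ∈ convexHull ℝ T}.Nonempty) :
    upperF T t ≤ upperF S t := by
  have hd : 0 < q.1 - p.1 := sub_pos.2 hpq
  set c := p.2 + (q.2 - p.2) * (t - p.1) / (q.1 - p.1) with hc
  have bound {U : Set (ℝ × ℝ)} (hU : ∀ z ∈ U, WeaklyBelow p q z) (y : ℝ)
      (hy : (t, y) ∈ convexHull ℝ U) : y ≤ c := by
    have h : WeaklyBelow p q (t, y) := convexHull_min hU (convex_setOf_weaklyBelow_s14 p q) hy
    rw [hc, ← sub_le_iff_le_add', le_div_iff₀ hd, mul_comm]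
    exact h
  have hmem : (t, c) ∈ convexHull ℝ S := by
    refine segment_subset_convexHull hp hq ⟨(q.1 - t) / (q.1 - p.1), (t - p.1) / (q.1 - p.1),
      div_nonneg (sub_nonneg.2 ht.2) hd.le, div_nonneg (sub_nonneg.2 ht.1) hd.le, ?_, ?_⟩
    · field_simp
      ring
    · ext
      · simp only [Prod.fst_add, Prod.smul_fst, smul_eq_mul]
        field_simp
        ring
      · simp only [Prod.snd_add, Prod.smul_snd, smul_eq_mul, hc]
        field_simp
        ring
  exact (csSup_le hne (bound hT)).trans (le_csSup ⟨c, bound hS⟩ hmem)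

/-- A finite planar set with points strictly on both sides of the vertical line over `t`, and none
on it, has a supporting line from above through two of its points that span `t`. -/
theorem exists_upper_supporting_line (P : Finset (ℝ × ℝ)) {t : ℝ} (ht : ∀ z ∈ P, z.1 ≠ t)
    (hl : ∃ p ∈ P, p.1 < t) (hr : ∃ q ∈ P, t < q.1) :
    ∃ p ∈ P, ∃ q ∈ P, p.1 < t ∧ t < q.1 ∧ ∀ z ∈ P, WeaklyBelow p q z := by
  classical
  obtain ⟨p₀, hp₀, hp₀t⟩ := hl
  obtain ⟨q₀, hq₀, hq₀t⟩ := hr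
  obtain ⟨⟨p, q⟩, hmem, hmax⟩ :=
    Finset.exists_max_image ({z ∈ P | z.1 < t} ×ˢ {z ∈ P | t < z.1})
      (fun r => (r.1.2 * (r.2.1 - t) + r.2.2 * (t - r.1.1)) / (r.2.1 - r.1.1))
      ⟨(p₀, q₀), by simp [*]⟩
  simp only [Finset.mem_product, Finset.mem_filter] at hmem hmax
  obtain ⟨⟨hp, hpt⟩, hq, hqt⟩ := hmem
  refine ⟨p, hp, q, hq, hpt, hqt, fun z hz => ?_⟩
  have hd : 0 < q.1 - p.1 := by linarith
  unfold WeaklyBelow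
  rcases (ht z hz).lt_or_gt with hzt | hzt
  · have h := hmax (z, q) ⟨⟨hz, hzt⟩, hq, hqt⟩
    rw [div_le_div_iff₀ (by dsimp only; linarith) hd] at h
    dsimp only at h
    refine le_of_mul_le_mul_left ?_ (sub_pos.2 hqt)
    linear_combination h
  · have h := hmax (p, z) ⟨⟨hp, hpt⟩, hz, hzt⟩
    rw [div_le_div_iff₀ (by dsimp only; linarith) hd] at h
    dsimp only at h
    refine le_of_mul_le_mul_left ?_ (sub_pos.2 hpt)
    linear_combination h

/-- Existence of a bridge above a crossing of two upper hulls: if on `[t⁻, t⁺]`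
the upper-hull functions of `A` and `B` are defined, cross exactly at `t₀`
(with `f_A < f_B` before and `f_A > f_B` after), and no point of `A ∪ B` has
abscissa `t₀`, then there are `a ∈ A` and `b ∈ B` spanning `t₀` such that every
point of `A ∪ B` lies weakly below the line through `a` and `b`. -/
theorem bridge_above_equality_point
    (A B : Finset (ℝ × ℝ)) (hA : A.Nonempty) (hB : B.Nonempty)
    (tm t₀ tp : ℝ) (h1 : tm < t₀) (h2 : t₀ < tp)
    (hAdef : ∀ t ∈ Icc tm tp, {y : ℝ | (t, y) ∈ convexHull ℝ (A : Set (ℝ × ℝ))}.Nonempty)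
    (hBdef : ∀ t ∈ Icc tm tp, {y : ℝ | (t, y) ∈ convexHull ℝ (B : Set (ℝ × ℝ))}.Nonempty)
    (hlt : ∀ t ∈ Ico tm t₀, upperF (A : Set (ℝ × ℝ)) t < upperF (B : Set (ℝ × ℝ)) t)
    (hgt : ∀ t ∈ Ioc t₀ tp, upperF (B : Set (ℝ × ℝ)) t < upperF (A : Set (ℝ × ℝ)) t)
    (ht₀ : ∀ z ∈ A ∪ B, z.1 ≠ t₀) :
    ∃ a ∈ A, ∃ b ∈ B,
      t₀ ∈ Ioo (min a.1 b.1) (max a.1 b.1) ∧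
      ((a.1 < b.1 ∧ ∀ z ∈ A ∪ B, WeaklyBelow a b z) ∨
       (b.1 < a.1 ∧ ∀ z ∈ A ∪ B, WeaklyBelow b a z)) := by
  obtain ⟨y, hy⟩ := hAdef t₀ ⟨h1.le, h2.le⟩
  obtain ⟨⟨p₀, hp₀, hp₀t⟩, q₀, hq₀, hq₀t⟩ := exists_fst_le_and_exists_le_fst hy
  have hp₀' : p₀ ∈ A ∪ B := Finset.mem_union_left _ hp₀
  have hq₀' : q₀ ∈ A ∪ B := Finset.mem_union_left _ hq₀
  obtain ⟨p, hp, q, hq, hpt, hqt, hbelow⟩ := exists_upper_supporting_line (A ∪ B) ht₀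
    ⟨p₀, hp₀', hp₀t.lt_of_ne (ht₀ p₀ hp₀')⟩ ⟨q₀, hq₀', hq₀t.lt_of_ne (ht₀ q₀ hq₀').symm⟩
  have hpq : p.1 < q.1 := hpt.trans hqt
  have hbelowA : ∀ z ∈ (A : Set (ℝ × ℝ)), WeaklyBelow p q z :=
    fun z hz => hbelow z (Finset.mem_union_left _ hz)
  have hbelowB : ∀ z ∈ (B : Set (ℝ × ℝ)), WeaklyBelow p q z :=
    fun z hz => hbelow z (Finset.mem_union_right _ hz)
  rcases Finset.mem_union.1 hp with hpA | hpB <;> rcases Finset.mem_union.1 hq with hqA | hqB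
  · have ht : max tm p.1 < t₀ := max_lt h1 hpt
    exact absurd (hlt _ ⟨le_max_left _ _, ht⟩) (not_lt.2
      (upperF_le_upperF_of_weaklyBelow hpA hqA hpq hbelowA hbelowB
        ⟨le_max_right _ _, (ht.trans hqt).le⟩ (hBdef _ ⟨le_max_left _ _, (ht.trans h2).le⟩)))
  · refine ⟨p, hpA, q, hqB, ?_, Or.inl ⟨hpq, hbelow⟩⟩
    rw [min_eq_left hpq.le, max_eq_right hpq.le]
    exact ⟨hpt, hqt⟩
  · refine ⟨q, hqA, p, hpB, ?_, Or.inr ⟨hpq, hbelow⟩⟩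
    rw [min_eq_right hpq.le, max_eq_left hpq.le]
    exact ⟨hpt, hqt⟩
  · have ht : t₀ < min tp q.1 := lt_min h2 hqt
    exact absurd (hgt _ ⟨ht, min_le_left _ _⟩) (not_lt.2
      (upperF_le_upperF_of_weaklyBelow hpB hqB hpq hbelowB hbelowA
        ⟨(hpt.trans ht).le, min_le_right _ _⟩ (hAdef _ ⟨(h1.trans ht).le, min_le_left _ _⟩)))
end
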